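/- arXiv:2510.01833 — 2 statements merged into one kernel-verified Lean document; each statement's English description precedes it below -/
import Mathlib

section
/- Let m ≥ 2 and let (p₁, …, p_m) be a probability vector (p_i ≥ 0 for all i and Σᵢ pᵢ = 1), and let p_max = maxᵢ pᵢ. Then 1 − p_max ≤ (1/2)·H(p₁, …, p_m), where H denotes the Shannon entropy. -/
open Real in
/-- If `0 ≤ x ≤ c`, then `x * log (1 / c)` is a lower bound for `-x log x`. -/
lemma neg_mul_log_le_negMulLog {x c : ℝ} (hx : 0 ≤ x) (hxc : x ≤ c) :
    -(x * log c) ≤ negMulLog x := by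
  rcases hx.eq_or_lt with rfl | hx
  · simp
  · have := mul_le_mul_of_nonneg_left (log_le_log hx hxc) hx.le
    rw [negMulLog]
    linarith

open Real in
/-- Entropy-type sums of numbers in `[0, c]` are at least `-(∑ i, p i) log c`. -/
lemma neg_sum_mul_log_le_sum_negMulLog {ι : Type*} (s : Finset ι) {p : ι → ℝ} {c : ℝ}
    (hnn : ∀ i ∈ s, 0 ≤ p i) (hc : ∀ i ∈ s, p i ≤ c) :
    -((∑ i ∈ s, p i) * log c) ≤ ∑ i ∈ s, negMulLog (p i) := by
  rw [Finset.sum_mul, ← Finset.sum_neg_distrib]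
  exact Finset.sum_le_sum fun i hi => neg_mul_log_le_negMulLog (hnn i hi) (hc i hi)

open Real in
/-- On `(0, 1/2]`, the graph of `-log` lies above the line through its points at `1/2` and `1`. -/
lemma two_mul_one_sub_mul_log_two_le_neg_log {x : ℝ} (hx : 0 < x) (hx2 : x ≤ 1 / 2) :
    2 * (1 - x) * log 2 ≤ -log x := by
  have h1 : 0 < 1 - x := by linarith
  have h := strictConcaveOn_log_Ioi.concaveOn.2 (Set.mem_Ioi.2 hx) (Set.mem_Ioi.2 one_pos)
    (show 0 ≤ 1 / (2 * (1 - x)) by positivity)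
    (show 0 ≤ 1 - 1 / (2 * (1 - x)) by
      rw [sub_nonneg, div_le_one (by positivity)]
      linarith)
    (by ring)
  have hmid : 1 / (2 * (1 - x)) * x + (1 - 1 / (2 * (1 - x))) * 1 = 2⁻¹ := by
    field_simp
    ring
  rw [smul_eq_mul, smul_eq_mul, smul_eq_mul, smul_eq_mul, hmid, log_one, mul_zero, add_zero,
    log_inv, div_mul_eq_mul_div, one_mul, div_le_iff₀ (by positivity)] at h
  linarith

open Real in
/-- On `[1/2, 1]`, the binary entropy lies above the chord through its points at `1/2` and `1`. -/
lemma two_mul_one_sub_mul_log_two_le_binEntropy {x : ℝ} (hx : 1 / 2 ≤ x) (hx1 : x ≤ 1) :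
    2 * (1 - x) * log 2 ≤ binEntropy x := by
  have h := strictConcave_binEntropy.concaveOn.2
    (show (2⁻¹ : ℝ) ∈ Set.Icc 0 1 by norm_num) (show (1 : ℝ) ∈ Set.Icc 0 1 by norm_num)
    (show 0 ≤ 2 * (1 - x) by linarith) (show 0 ≤ 2 * x - 1 by linarith) (by ring)
  have hmid : 2 * (1 - x) * 2⁻¹ + (2 * x - 1) * 1 = x := by ring
  simpa only [smul_eq_mul, hmid, binEntropy_two_inv, binEntropy_one, mul_zero, add_zero] using h

open Real in
/-- A probability vector with maximal entry `p j` has entropy (in nats) at least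
`2 (1 - p j) log 2`. -/
lemma two_mul_one_sub_mul_log_two_le_sum_negMulLog {ι : Type*} [Fintype ι] {p : ι → ℝ} {j : ι}
    (hnn : ∀ i, 0 ≤ p i) (hsum : ∑ i, p i = 1) (hj : ∀ i, p i ≤ p j) :
    2 * (1 - p j) * log 2 ≤ ∑ i, negMulLog (p i) := by
  classical
  rcases le_total (p j) (1 / 2) with hle | hge
  · have hpos : 0 < p j := by
      by_contra! h
      have : ∑ i, p i ≤ 0 := Finset.sum_nonpos fun i _ => (hj i).trans h
      linarith
    have h := neg_sum_mul_log_le_sum_negMulLog Finset.univ (fun i _ => hnn i) fun i _ => hj i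
    rw [hsum, one_mul] at h
    exact (two_mul_one_sub_mul_log_two_le_neg_log hpos hle).trans h
  · have hrest : ∑ i ∈ Finset.univ.erase j, p i = 1 - p j := by
      rw [← hsum, ← Finset.add_sum_erase _ p (Finset.mem_univ j), add_sub_cancel_left]
    have hle1 : p j ≤ 1 := hsum ▸ Finset.single_le_sum (fun i _ => hnn i) (Finset.mem_univ j)
    have h := neg_sum_mul_log_le_sum_negMulLog (Finset.univ.erase j) (c := 1 - p j)
      (fun i _ => hnn i)
      fun i hi => hrest ▸ Finset.single_le_sum (fun i _ => hnn i) hi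
    rw [hrest, ← neg_mul, ← negMulLog] at h
    rw [← Finset.add_sum_erase _ _ (Finset.mem_univ j)]
    have hb := two_mul_one_sub_mul_log_two_le_binEntropy hge hle1
    rw [binEntropy_eq_negMulLog_add_negMulLog_one_sub] at hb
    linarith

/-- Generalized Fano-type lemma: for a probability vector `(p₁, …, p_m)` with
`m ≥ 2`, `1 - max_i p_i ≤ (1/2)·H(p₁, …, p_m)`, where
`H(p) = ∑ i, -(p i · log₂ (p i))` is the Shannon entropy
(with the convention `0·log₂ 0 = 0`). -/
theorem one_sub_max_le_half_entropy (m : ℕ) (hm : 2 ≤ m) (p : Fin m → ℝ)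
    (hnn : ∀ i, 0 ≤ p i) (hsum : ∑ i, p i = 1) :
    1 - Finset.univ.sup' ⟨⟨0, by omega⟩, Finset.mem_univ _⟩ p ≤
      (1 / 2) * ∑ i, -(p i * Real.logb 2 (p i)) := by
  obtain ⟨j, -, hj⟩ := Finset.exists_mem_eq_sup' (s := Finset.univ)
    ⟨⟨0, by omega⟩, Finset.mem_univ _⟩ p
  have hmax : ∀ i, p i ≤ p j := fun i => hj ▸ Finset.le_sup' p (Finset.mem_univ i)
  have h := two_mul_one_sub_mul_log_two_le_sum_negMulLog hnn hsum hmax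
  have hlogb : ∑ i, -(p i * Real.logb 2 (p i)) = (∑ i, Real.negMulLog (p i)) / Real.log 2 := by
    rw [Finset.sum_div]
    refine Finset.sum_congr rfl fun i _ => ?_
    rw [Real.negMulLog, Real.logb]
    ring
  rw [← le_div_iff₀ (Real.log_pos one_lt_two)] at h
  rw [hj, hlogb]
  linarith
end

section
/- Let (Ω, P) be a finite probability space and let Q, T, Y be random variables on Ω taking values in finite types. Define the conditional Bayes error at a pair (q, t) with P(Q = q, T = t) > 0 as p_e(q, t) = 1 − max_{y'} P(Y = y' | Q = q, T = t), and let p_error = E_{(q,t)}[p_e(q, t)] = Σ_{q,t} P(Q = q, T = t)·p_e(q, t). Then p_error ≤ (1/2)·H(Y | Q, T), where H(Y | Q, T) is the conditional Shannon entropy of Y given (Q, T). -/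
open scoped Classical

noncomputable section

/-- Probability of an event `E` in a finite probability space with mass
function `P`. -/
def prob {Ω : Type*} [Fintype Ω] (P : Ω → ℝ) (E : Ω → Prop) : ℝ :=
  ∑ ω, if E ω then P ω else 0

/-- Conditional probability `P(E | F)` (with the convention `x / 0 = 0`). -/
def cprob {Ω : Type*} [Fintype Ω] (P : Ω → ℝ) (E F : Ω → Prop) : ℝ :=
  prob P (fun ω => E ω ∧ F ω) / prob P F

/-- Conditional Shannon entropy `H(Y | Z)` (base-2 logarithm, with the
convention `0·log₂ 0 = 0`):
`H(Y|Z) = ∑ z, P(Z = z) · ∑ y, -(P(Y = y | Z = z) · log₂ P(Y = y | Z = z))`. -/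
def condEnt {Ω γ δ : Type*} [Fintype Ω] [Fintype γ] [Fintype δ]
    (P : Ω → ℝ) (Y : Ω → γ) (Z : Ω → δ) : ℝ :=
  ∑ z : δ, prob P (fun ω => Z ω = z) *
    ∑ y : γ, -(cprob P (fun ω => Y ω = y) (fun ω => Z ω = z) *
      Real.logb 2 (cprob P (fun ω => Y ω = y) (fun ω => Z ω = z)))

lemma log_le_neg_two_mul_one_sub_mul_log_two {x : ℝ} (hx : 0 < x) (hx' : x ≤ 1 / 2) :
    Real.log x ≤ -(2 * (1 - x) * Real.log 2) := by
  have hd : 0 < 2 * (1 - x) := by linarith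
  have ha : 0 ≤ 1 / (2 * (1 - x)) := by positivity
  have hb : 0 ≤ 1 - 1 / (2 * (1 - x)) := by rw [sub_nonneg, div_le_one hd]; linarith
  have h := strictConcaveOn_log_Ioi.concaveOn.2 (Set.mem_Ioi.2 hx) (Set.mem_Ioi.2 one_pos)
    ha hb (by ring)
  have hcomb : 1 / (2 * (1 - x)) * x + (1 - 1 / (2 * (1 - x))) * 1 = 2⁻¹ := by
    have : 1 - x ≠ 0 := by linarith
    field_simp
    ring
  simp only [smul_eq_mul] at h
  rw [hcomb, Real.log_one, mul_zero, add_zero, Real.log_inv, one_div_mul_eq_div,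
    div_le_iff₀ hd] at h
  linarith

lemma two_mul_one_sub_mul_log_two_le_binEntropy_s3 {x : ℝ} (hx : 1 / 2 ≤ x) (hx' : x ≤ 1) :
    2 * (1 - x) * Real.log 2 ≤ Real.binEntropy x := by
  have ha : 0 ≤ 2 * (1 - x) := by linarith
  have hb : 0 ≤ 2 * x - 1 := by linarith
  have hhalf : (2⁻¹ : ℝ) ∈ Set.Icc 0 1 := by norm_num
  have h := Real.strictConcave_binEntropy.concaveOn.2 hhalf
    (Set.right_mem_Icc.2 zero_le_one) ha hb (by ring)
  have hcomb : 2 * (1 - x) * 2⁻¹ + (2 * x - 1) * 1 = x := by ring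
  simp only [smul_eq_mul] at h
  rwa [hcomb, Real.binEntropy_two_inv, Real.binEntropy_one, mul_zero, add_zero] at h

lemma mul_neg_log_le_negMulLog {x y : ℝ} (hx : 0 ≤ x) (hxy : x ≤ y) :
    x * -Real.log y ≤ Real.negMulLog x := by
  rcases hx.eq_or_lt with rfl | hx
  · simp
  · rw [Real.negMulLog]
    nlinarith [Real.log_le_log hx hxy]

/-- A maximal mass of at most `1 / 2` makes the entropy at least the min-entropy; otherwise grouping the
remaining masses bounds it below by a binary entropy. -/
lemma two_mul_one_sub_mul_log_two_le_sum_negMulLog_s3 {γ : Type*} [Fintype γ] (p : γ → ℝ)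
    (hp : ∀ y, 0 ≤ p y) (hsum : ∑ y, p y = 1) (y₀ : γ) (hmax : ∀ y, p y ≤ p y₀) :
    2 * (1 - p y₀) * Real.log 2 ≤ ∑ y, Real.negMulLog (p y) := by
  rcases le_total (p y₀) (1 / 2) with h | h
  · have hpos : 0 < p y₀ := by
      by_contra! hle
      have : ∑ y, p y ≤ 0 := Finset.sum_nonpos fun y _ => (hmax y).trans hle
      linarith
    calc 2 * (1 - p y₀) * Real.log 2 ≤ -Real.log (p y₀) := by
          linarith [log_le_neg_two_mul_one_sub_mul_log_two hpos h]
      _ = ∑ y, p y * -Real.log (p y₀) := by rw [← Finset.sum_mul, hsum, one_mul]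
      _ ≤ _ := Finset.sum_le_sum fun y _ => mul_neg_log_le_negMulLog (hp y) (hmax y)
  · have hrest : ∑ y ∈ Finset.univ.erase y₀, p y = 1 - p y₀ := by
      rw [← hsum, ← Finset.add_sum_erase _ _ (Finset.mem_univ y₀)]
      ring
    have hle : ∀ y ∈ Finset.univ.erase y₀, p y ≤ 1 - p y₀ := fun y hy =>
      hrest ▸ Finset.single_le_sum (fun z _ => hp z) hy
    have hone : p y₀ ≤ 1 := hsum ▸ Finset.single_le_sum (fun z _ => hp z) (Finset.mem_univ y₀)
    calc 2 * (1 - p y₀) * Real.log 2 ≤ Real.binEntropy (p y₀) :=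
          two_mul_one_sub_mul_log_two_le_binEntropy_s3 h hone
      _ = Real.negMulLog (p y₀) +
            ∑ y ∈ Finset.univ.erase y₀, p y * -Real.log (1 - p y₀) := by
          rw [Real.binEntropy_eq_negMulLog_add_negMulLog_one_sub, ← Finset.sum_mul, hrest,
            Real.negMulLog, Real.negMulLog]
          ring
      _ ≤ Real.negMulLog (p y₀) + ∑ y ∈ Finset.univ.erase y₀, Real.negMulLog (p y) := by
          gcongr with y hy
          exact mul_neg_log_le_negMulLog (hp y) (hle y hy)
      _ = _ := Finset.add_sum_erase _ (fun y => Real.negMulLog (p y)) (Finset.mem_univ y₀)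

lemma one_sub_sup'_le_half_entropy {γ : Type*} [Fintype γ] [Nonempty γ] (p : γ → ℝ)
    (hp : ∀ y, 0 ≤ p y) (hsum : ∑ y, p y = 1) :
    1 - Finset.univ.sup' Finset.univ_nonempty p ≤
      (1 / 2) * ∑ y, -(p y * Real.logb 2 (p y)) := by
  obtain ⟨y₀, -, hy₀⟩ := Finset.exists_mem_eq_sup' Finset.univ_nonempty p
  have h := two_mul_one_sub_mul_log_two_le_sum_negMulLog_s3 p hp hsum y₀ fun y =>
    hy₀ ▸ Finset.le_sup' p (Finset.mem_univ y)
  have hent : ∑ y, -(p y * Real.logb 2 (p y)) = (∑ y, Real.negMulLog (p y)) / Real.log 2 := by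
    rw [Finset.sum_div]
    refine Finset.sum_congr rfl fun y _ => ?_
    rw [Real.logb, Real.negMulLog]
    ring
  rw [← le_div_iff₀ (Real.log_pos one_lt_two), ← hent] at h
  rw [hy₀]
  linarith

lemma prob_nonneg {Ω : Type*} [Fintype Ω] {P : Ω → ℝ} (hP : ∀ ω, 0 ≤ P ω) (E : Ω → Prop) :
    0 ≤ prob P E :=
  Finset.sum_nonneg fun ω _ => by split_ifs <;> simp [hP]

lemma sum_prob_eq_and {Ω γ : Type*} [Fintype Ω] [Fintype γ] (P : Ω → ℝ) (Y : Ω → γ)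
    (F : Ω → Prop) : ∑ y, prob P (fun ω => Y ω = y ∧ F ω) = prob P F := by
  unfold prob
  rw [Finset.sum_comm]
  refine Finset.sum_congr rfl fun ω _ => ?_
  by_cases hF : F ω <;> simp [hF]

lemma sum_cprob_eq_one {Ω γ : Type*} [Fintype Ω] [Fintype γ] (P : Ω → ℝ) (Y : Ω → γ)
    {F : Ω → Prop} (hF : prob P F ≠ 0) : ∑ y, cprob P (fun ω => Y ω = y) F = 1 := by
  simp only [cprob, ← Finset.sum_div, sum_prob_eq_and, div_self hF]

/-- Let `(Ω, P)` be a finite probability space and `Q, T, Y` random variables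
on `Ω` with values in finite types.  With the conditional Bayes error
`p_e(q,t) = 1 - max_{y'} P(Y = y' | Q = q, T = t)` and
`p_error = ∑_{q,t} P(Q = q, T = t) · p_e(q,t)`, one has
`p_error ≤ (1/2)·H(Y | Q, T)`. -/
theorem expected_bayes_error_le_half_condEnt
    {Ω α β γ : Type*} [Fintype Ω] [Fintype α] [Fintype β] [Fintype γ] [Nonempty γ]
    (P : Ω → ℝ) (hP : ∀ ω, 0 ≤ P ω) (hPsum : ∑ ω, P ω = 1)
    (Q : Ω → α) (T : Ω → β) (Y : Ω → γ) :
    (∑ q : α, ∑ t : β,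
        prob P (fun ω => Q ω = q ∧ T ω = t) *
          (1 - Finset.univ.sup' Finset.univ_nonempty
            (fun y' : γ => cprob P (fun ω => Y ω = y') (fun ω => Q ω = q ∧ T ω = t)))) ≤
      (1 / 2) * condEnt P Y (fun ω => (Q ω, T ω)) := by
  rw [condEnt, Fintype.sum_prod_type, Finset.mul_sum]
  refine Finset.sum_le_sum fun q _ => ?_
  rw [Finset.mul_sum]
  refine Finset.sum_le_sum fun t _ => ?_
  simp only [Prod.mk.injEq]
  set F : Ω → Prop := fun ω => Q ω = q ∧ T ω = t
  by_cases hF : prob P F = 0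
  · simp [hF]
  · rw [mul_left_comm]
    refine mul_le_mul_of_nonneg_left ?_ (prob_nonneg hP F)
    exact one_sub_sup'_le_half_entropy (fun y => cprob P (fun ω => Y ω = y) F)
      (fun y => div_nonneg (prob_nonneg hP _) (prob_nonneg hP F)) (sum_cprob_eq_one P Y hF)

end
end
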